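/- arXiv:0704.2786 — 14 statements merged into one kernel-verified Lean document; each statement's English description precedes it below -/
import Mathlib

section
/- For all real parameters P, Q, N > 0 and every α ≥ 0, the function a ↦ J(α, a) is strictly increasing on [0, ∞). -/
/-- The conditional DPC achievable rate
`J(α, a) = log( P·(a·(P+Q) + N) / ((1−α)²·a·P·Q + (P + α²·Q)·N) )`. -/
noncomputable def J (P Q N α a : ℝ) : ℝ :=
  Real.log (P * (a * (P + Q) + N) /
    ((1 - α) ^ 2 * a * P * Q + (P + α ^ 2 * Q) * N))

/-- For all parameters `P, Q, N > 0` and every `α ≥ 0`, the map `a ↦ J(α, a)` is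
strictly increasing on `[0, ∞)`. -/
theorem stmt_0 (P Q N α : ℝ) (hP : 0 < P) (hQ : 0 < Q) (hN : 0 < N) (hα : 0 ≤ α) :
    StrictMonoOn (fun a => J P Q N α a) (Set.Ici (0 : ℝ)) := by
  intro a ha b hb hab
  have ha : 0 ≤ a := ha
  have hb : 0 ≤ b := hb
  have hda : 0 < (1 - α) ^ 2 * a * P * Q + (P + α ^ 2 * Q) * N := by positivity
  have hdb : 0 < (1 - α) ^ 2 * b * P * Q + (P + α ^ 2 * Q) * N := by positivity
  refine Real.log_lt_log (by positivity) ?_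
  rw [div_lt_div_iff₀ hda hdb, ← sub_pos]
  have hba : 0 < b - a := sub_pos.mpr hab
  have hpos : 0 < P * N * (b - a) * (P + α * Q) ^ 2 := by positivity
  linear_combination hpos
end

section
/- For all real parameters P, Q, N > 0 and every fixed a > 0, the inequality J(α, a) ≤ log(1 + a·P/N) holds for all α ∈ ℝ, with equality if and only if α = a·P/(a·P + N). -/
/-- Completing the square in `α` in the denominator of the DPC rate. -/
theorem dpc_denominator_mul (P Q N α a : ℝ) :
    (a * P + N) * ((1 - α) ^ 2 * a * P * Q + (P + α ^ 2 * Q) * N) =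
      N * (P * (a * (P + Q) + N)) + Q * (α * (a * P + N) - a * P) ^ 2 := by
  ring

/-- For all parameters `P, Q, N > 0` and every fixed `a > 0`,
`J(α, a) ≤ log(1 + a·P/N)` for all `α ∈ ℝ`, with equality iff `α = a·P/(a·P + N)`. -/
theorem stmt_1 (P Q N a : ℝ) (hP : 0 < P) (hQ : 0 < Q) (hN : 0 < N) (ha : 0 < a) :
    ∀ α : ℝ, J P Q N α a ≤ Real.log (1 + a * P / N) ∧
      (J P Q N α a = Real.log (1 + a * P / N) ↔ α = a * P / (a * P + N)) := by
  intro α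
  have hD : 0 < (1 - α) ^ 2 * a * P * Q + (P + α ^ 2 * Q) * N := by positivity
  have hR : 1 + a * P / N = (a * P + N) / N := by field_simp; ring
  have hS : 0 < a * P + N := by positivity
  have key := dpc_denominator_mul P Q N α a
  have hL : 0 < P * (a * (P + Q) + N) /
      ((1 - α) ^ 2 * a * P * Q + (P + α ^ 2 * Q) * N) := by positivity
  have hR0 : 0 < (a * P + N) / N := by positivity
  rw [J, hR]
  constructor
  · apply Real.log_le_log hL
    rw [div_le_div_iff₀ hD hN, key]
    nlinarith [mul_nonneg hQ.le (sq_nonneg (α * (a * P + N) - a * P))]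
  · rw [Real.log_injOn_pos.eq_iff hL hR0, div_eq_div_iff hD.ne' hN.ne', key,
      eq_div_iff hS.ne', mul_comm _ N, left_eq_add, mul_eq_zero_iff_left hQ.ne',
      sq_eq_zero_iff, sub_eq_zero]
end

section
/- Let P, Q, N > 0, R ≥ 0, and α ∈ ℝ satisfy P + Q − (1−α)²·e^R·Q > 0. Then for every a ≥ 0, J(α, a) ≤ R if and only if a ≤ ((e^R − 1)·P·N + α²·e^R·Q·N) / (P·(P + Q − (1−α)²·e^R·Q)). -/
/-- Let `P, Q, N > 0`, `R ≥ 0`, and `α` satisfy `P + Q − (1−α)²·e^R·Q > 0`.  Then for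
every `a ≥ 0`, `J(α, a) ≤ R` iff
`a ≤ ((e^R − 1)·P·N + α²·e^R·Q·N) / (P·(P + Q − (1−α)²·e^R·Q))`. -/
theorem stmt_2 (P Q N R α : ℝ) (hP : 0 < P) (hQ : 0 < Q) (hN : 0 < N) (hR : 0 ≤ R)
    (hα : 0 < P + Q - (1 - α) ^ 2 * Real.exp R * Q) :
    ∀ a : ℝ, 0 ≤ a →
      (J P Q N α a ≤ R ↔
        a ≤ ((Real.exp R - 1) * P * N + α ^ 2 * Real.exp R * Q * N) /
          (P * (P + Q - (1 - α) ^ 2 * Real.exp R * Q))) := by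
  intro a ha
  have hden : 0 < (1 - α) ^ 2 * a * P * Q + (P + α ^ 2 * Q) * N := by positivity
  have hratio : 0 < P * (a * (P + Q) + N) /
      ((1 - α) ^ 2 * a * P * Q + (P + α ^ 2 * Q) * N) := by positivity
  rw [J, Real.log_le_iff_le_exp hratio, div_le_iff₀ hden, le_div_iff₀ (mul_pos hP hα)]
  constructor <;> intro h <;> linarith
end

section
/- Let P, Q, N > 0 and R ≥ 0. For every α ∈ ℝ with P + Q − (1−α)²·e^R·Q > 0, the outage threshold T(α) := ((e^R − 1)·P·N + α²·e^R·Q·N) / (P·(P + Q − (1−α)²·e^R·Q)) satisfies T(α) ≥ (e^R − 1)·N/P, and equality holds at α = 1 − e^{−R}. -/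
/-- The outage threshold of the DPC scheme:
`T(α) = ((e^R − 1)·P·N + α²·e^R·Q·N) / (P·(P + Q − (1−α)²·e^R·Q))`. -/
noncomputable def outageThreshold (P Q N R α : ℝ) : ℝ :=
  ((Real.exp R - 1) * P * N + α ^ 2 * Real.exp R * Q * N) /
    (P * (P + Q - (1 - α) ^ 2 * Real.exp R * Q))

/-- The excess of the outage threshold over `(e^R − 1)·N/P` is a square over a denominator. -/
theorem outageThreshold_eq_add_sq {P Q R α : ℝ} (N : ℝ) (hP : P ≠ 0)
    (hD : P + Q - (1 - α) ^ 2 * Real.exp R * Q ≠ 0) :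
    outageThreshold P Q N R α = (Real.exp R - 1) * N / P +
      N * Q * (Real.exp R * α - (Real.exp R - 1)) ^ 2 /
        (P * (P + Q - (1 - α) ^ 2 * Real.exp R * Q)) := by
  rw [outageThreshold, div_add_div _ _ hP (mul_ne_zero hP hD),
    div_eq_div_iff (mul_ne_zero hP hD) (mul_ne_zero hP (mul_ne_zero hP hD))]
  ring

/-- Let `P, Q, N > 0` and `R ≥ 0`.  For every `α` with `P + Q − (1−α)²·e^R·Q > 0`, the
outage threshold satisfies `T(α) ≥ (e^R − 1)·N/P`, with equality at `α = 1 − e^{−R}`. -/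
theorem stmt_3 (P Q N R : ℝ) (hP : 0 < P) (hQ : 0 < Q) (hN : 0 < N) (hR : 0 ≤ R) :
    (∀ α : ℝ, 0 < P + Q - (1 - α) ^ 2 * Real.exp R * Q →
      (Real.exp R - 1) * N / P ≤ outageThreshold P Q N R α) ∧
    outageThreshold P Q N R (1 - Real.exp (-R)) = (Real.exp R - 1) * N / P := by
  refine ⟨fun α hD => ?_, ?_⟩
  · rw [outageThreshold_eq_add_sq N hP.ne' hD.ne']
    exact le_add_of_nonneg_right (by positivity)
  · have hinv : Real.exp R * Real.exp (-R) = 1 := by rw [← Real.exp_add]; simp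
    have hle : Real.exp (-R) ≤ 1 := Real.exp_le_one_iff.mpr (by linarith)
    have hD : 0 < P + Q - (1 - (1 - Real.exp (-R))) ^ 2 * Real.exp R * Q := by
      have : (1 - (1 - Real.exp (-R))) ^ 2 * Real.exp R * Q = Real.exp (-R) * Q := by
        linear_combination Real.exp (-R) * Q * hinv
      rw [this]
      nlinarith
    have hzero : Real.exp R * (1 - Real.exp (-R)) - (Real.exp R - 1) = 0 := by
      linear_combination -hinv
    rw [outageThreshold_eq_add_sq N hP.ne' hD.ne', hzero]
    simp
end

section
/- Let P, Q, N > 0, R ≥ 0, and set α* := 1 − e^{−R}. Then for every a ≥ 0, J(α*, a) ≤ R if and only if log(1 + a·P/N) ≤ R (equivalently, if and only if a ≤ (e^R − 1)·N/P). -/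
/-- Let `P, Q, N > 0`, `R ≥ 0`, and `α* = 1 − e^{−R}`.  Then for every `a ≥ 0`,
`J(α*, a) ≤ R` iff `log(1 + a·P/N) ≤ R`, equivalently iff `a ≤ (e^R − 1)·N/P`. -/
theorem stmt_4 (P Q N R : ℝ) (hP : 0 < P) (hQ : 0 < Q) (hN : 0 < N) (hR : 0 ≤ R) :
    ∀ a : ℝ, 0 ≤ a →
      (J P Q N (1 - Real.exp (-R)) a ≤ R ↔ Real.log (1 + a * P / N) ≤ R) ∧
      (J P Q N (1 - Real.exp (-R)) a ≤ R ↔ a ≤ (Real.exp R - 1) * N / P) := by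
  intro a ha
  have ht : 0 < Real.exp (-R) := Real.exp_pos _
  have ht1 : Real.exp (-R) ≤ 1 := Real.exp_le_one_iff.2 (by linarith)
  have hE : 0 < Real.exp R := Real.exp_pos _
  have htE : Real.exp (-R) * Real.exp R = 1 := by rw [← Real.exp_add]; simp
  have hlog : Real.log (1 + a * P / N) ≤ R ↔ a ≤ (Real.exp R - 1) * N / P := by
    rw [Real.log_le_iff_le_exp (by positivity), le_div_iff₀ hP, ← le_sub_iff_add_le',
      div_le_iff₀ hN]
  have hJ : J P Q N (1 - Real.exp (-R)) a ≤ R ↔ a ≤ (Real.exp R - 1) * N / P := by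
    unfold J
    generalize Real.exp (-R) = t at *
    have hD : 0 < (1 - (1 - t)) ^ 2 * a * P * Q + (P + (1 - t) ^ 2 * Q) * N := by positivity
    rw [Real.log_le_iff_le_exp (by positivity), div_le_iff₀ hD, le_div_iff₀ hP]
    generalize Real.exp R = E at *
    have hc : 0 < P + Q * (1 - t) := add_pos_of_pos_of_nonneg hP (mul_nonneg hQ.le (by linarith))
    have key : E * ((1 - (1 - t)) ^ 2 * a * P * Q + (P + (1 - t) ^ 2 * Q) * N)
        - P * (a * (P + Q) + N) = (P + Q * (1 - t)) * ((E - 1) * N - a * P) := by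
      linear_combination (t * a * P * Q - (1 - t) * Q * N) * htE
    rw [← sub_nonneg, key, mul_nonneg_iff_of_pos_left hc, sub_nonneg]
  exact ⟨hJ.trans hlog.symm, hJ⟩
end

section
/- Let P, Q, N > 0, R ≥ 0, and let A be a nonnegative real random variable on a probability space. For every α ∈ ℝ with P + Q − (1−α)²·e^R·Q > 0, the outage probability satisfies ℙ[J(α, A) ≤ R] ≥ ℙ[A ≤ (e^R − 1)·N/P], and equality holds for α = 1 − e^{−R}. Hence the minimum outage probability of the DPC scheme over such α equals ℙ[A ≤ (e^R − 1)·N/P], the outage probability of the interference-free channel. -/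
open MeasureTheory
open scoped ENNReal

/-- Outage event in linear form, with the threshold `e^R - 1` of the interference-free channel
separated from a perfect square. -/
lemma J_le_iff {P Q N α a R : ℝ} (hP : 0 < P) (hQ : 0 < Q) (hN : 0 < N) (ha : 0 ≤ a) :
    J P Q N α a ≤ R ↔
      (P + Q - (1 - α) ^ 2 * Real.exp R * Q) * (a * P - (Real.exp R - 1) * N) ≤
        N * Q * (Real.exp R * α - (Real.exp R - 1)) ^ 2 := by
  have hden : 0 < (1 - α) ^ 2 * a * P * Q + (P + α ^ 2 * Q) * N := by positivity
  have hnum : 0 < P * (a * (P + Q) + N) := by positivity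
  rw [J, Real.log_le_iff_le_exp (div_pos hnum hden), div_le_iff₀ hden]
  constructor <;> intro h <;> linarith

lemma J_le_of_le {P Q N α a R : ℝ} (hP : 0 < P) (hQ : 0 < Q) (hN : 0 < N) (ha : 0 ≤ a)
    (hα : 0 < P + Q - (1 - α) ^ 2 * Real.exp R * Q) (h : a ≤ (Real.exp R - 1) * N / P) :
    J P Q N α a ≤ R := by
  rw [le_div_iff₀ hP] at h
  rw [J_le_iff hP hQ hN ha]
  exact (mul_nonpos_of_nonneg_of_nonpos hα.le (sub_nonpos.2 h)).trans (by positivity)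

lemma optimal_coeff_admissible {P Q R : ℝ} (hP : 0 < P) (hQ : 0 < Q) (hR : 0 ≤ R) :
    0 < P + Q - (1 - (1 - Real.exp (-R))) ^ 2 * Real.exp R * Q := by
  have h : (1 - (1 - Real.exp (-R))) ^ 2 * Real.exp R = Real.exp (-R) := by
    rw [sub_sub_cancel, sq, mul_assoc, ← Real.exp_add, neg_add_cancel, Real.exp_zero, mul_one]
  have h1 : Real.exp (-R) ≤ 1 := Real.exp_le_one_iff.2 (neg_nonpos.2 hR)
  rw [h]
  nlinarith

lemma J_optimal_le_iff {P Q N a R : ℝ} (hP : 0 < P) (hQ : 0 < Q) (hN : 0 < N) (hR : 0 ≤ R)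
    (ha : 0 ≤ a) :
    J P Q N (1 - Real.exp (-R)) a ≤ R ↔ a ≤ (Real.exp R - 1) * N / P := by
  have h : Real.exp R * (1 - Real.exp (-R)) - (Real.exp R - 1) = 0 := by
    rw [mul_sub, ← Real.exp_add, add_neg_cancel, Real.exp_zero]
    ring
  rw [J_le_iff hP hQ hN ha, h, le_div_iff₀ hP, zero_pow two_ne_zero, mul_zero,
    ← sub_nonpos (a := a * P)]
  have hpos := optimal_coeff_admissible hP hQ hR
  exact ⟨fun h ↦ nonpos_of_mul_nonpos_right h hpos, mul_nonpos_of_nonneg_of_nonpos hpos.le⟩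

/-- Let `P, Q, N > 0`, `R ≥ 0`, and let `A` be a nonnegative real random variable.
For every `α` with `P + Q − (1−α)²·e^R·Q > 0`, the outage probability satisfies
`ℙ[J(α, A) ≤ R] ≥ ℙ[A ≤ (e^R − 1)·N/P]`, with equality for `α = 1 − e^{−R}`.
Hence the minimum outage probability of the DPC scheme over such `α` equals
`ℙ[A ≤ (e^R − 1)·N/P]`, the outage probability of the interference-free channel. -/
theorem stmt_5 {Ω : Type*} [MeasurableSpace Ω] (μ : Measure Ω) [IsProbabilityMeasure μ]
    (A : Ω → ℝ) (hAmeas : Measurable A) (hApos : ∀ ω, 0 ≤ A ω)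
    (P Q N R : ℝ) (hP : 0 < P) (hQ : 0 < Q) (hN : 0 < N) (hR : 0 ≤ R) :
    (∀ α : ℝ, 0 < P + Q - (1 - α) ^ 2 * Real.exp R * Q →
      μ {ω | A ω ≤ (Real.exp R - 1) * N / P} ≤ μ {ω | J P Q N α (A ω) ≤ R}) ∧
    μ {ω | J P Q N (1 - Real.exp (-R)) (A ω) ≤ R}
      = μ {ω | A ω ≤ (Real.exp R - 1) * N / P} ∧
    IsLeast {p : ℝ≥0∞ | ∃ α : ℝ, 0 < P + Q - (1 - α) ^ 2 * Real.exp R * Q ∧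
        p = μ {ω | J P Q N α (A ω) ≤ R}}
      (μ {ω | A ω ≤ (Real.exp R - 1) * N / P}) := by
  have lower (α : ℝ) (hα : 0 < P + Q - (1 - α) ^ 2 * Real.exp R * Q) :
      μ {ω | A ω ≤ (Real.exp R - 1) * N / P} ≤ μ {ω | J P Q N α (A ω) ≤ R} :=
    measure_mono fun ω hω ↦ J_le_of_le hP hQ hN (hApos ω) hα hω
  have attained : μ {ω | J P Q N (1 - Real.exp (-R)) (A ω) ≤ R}
      = μ {ω | A ω ≤ (Real.exp R - 1) * N / P} := by
    simp only [J_optimal_le_iff hP hQ hN hR (hApos _)]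
  refine ⟨lower, attained, ⟨_, optimal_coeff_admissible hP hQ hR, attained.symm⟩, ?_⟩
  rintro _ ⟨α, hα, rfl⟩
  exact lower α hα
end

section
/- For every fixed ρ > 0 and a > 0, the function β ↦ ((a·ρ + 1)·((β+1)·ρ² + (β·a + 2)·ρ + 1)) / ((ρ+1)²·((β+1)·a·ρ + 1)) is monotone nondecreasing on [0, ∞). -/
/-- For every fixed `ρ > 0` and `a > 0`, the function
`β ↦ ((a·ρ + 1)·((β+1)·ρ² + (β·a + 2)·ρ + 1)) / ((ρ+1)²·((β+1)·a·ρ + 1))`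
is monotone nondecreasing on `[0, ∞)`. -/
theorem stmt_7 (ρ a : ℝ) (hρ : 0 < ρ) (ha : 0 < a) :
    MonotoneOn
      (fun β : ℝ =>
        (a * ρ + 1) * ((β + 1) * ρ ^ 2 + (β * a + 2) * ρ + 1) /
          ((ρ + 1) ^ 2 * ((β + 1) * a * ρ + 1)))
      (Set.Ici (0 : ℝ)) := by
  intro x hx y hy hxy
  rw [Set.mem_Ici] at hx hy
  have hcross : 0 ≤ (a * ρ + 1) * (ρ + 1) ^ 2 * ((y - x) * (ρ * (a - 1)) ^ 2) :=
    mul_nonneg (by positivity) (mul_nonneg (sub_nonneg.2 hxy) (sq_nonneg _))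
  refine (div_le_div_iff₀ (by positivity) (by positivity)).2 ?_
  linear_combination hcross
end

section
/- Suppose additionally that log A is integrable. Then for every ρ > 0 and every β ≥ 0, the rate gap Δ(ρ, β) := C̄(ρ) − R(ρ, β) satisfies Δ(ρ, β) ≤ Δ̄(ρ) := E[ log(ρ + A) + log(ρ + 1/A) ] − 2·log(ρ + 1). -/
open MeasureTheory

/-- The logarithm of a positive affine function of a nonnegative integrable function is
integrable. -/
theorem integrable_log_const_add_mul {Ω : Type*} [MeasurableSpace Ω] {μ : Measure Ω}
    [IsFiniteMeasure μ] {A : Ω → ℝ} (hA : Integrable A μ) (hA0 : ∀ᵐ ω ∂μ, 0 ≤ A ω)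
    {a b : ℝ} (ha : 0 < a) (hb : 0 ≤ b) :
    Integrable (fun ω => Real.log (a + b * A ω)) μ := by
  have hbd : Integrable (fun ω => |Real.log a| + (a + b * A ω)) μ :=
    (integrable_const _).add ((integrable_const _).add (hA.const_mul b))
  refine hbd.mono' ?_ ?_
  · exact (Real.measurable_log.comp_aemeasurable
      ((hA.aemeasurable.const_mul b).const_add a)).aestronglyMeasurable
  · filter_upwards [hA0] with ω hω
    have hbA : 0 ≤ b * A ω := mul_nonneg hb hω
    have hlow : Real.log a ≤ Real.log (a + b * A ω) := Real.log_le_log ha (by linarith)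
    have hup := Real.log_le_self (x := a + b * A ω) (by linarith)
    rw [Real.norm_eq_abs, abs_le]
    constructor
    · linarith [neg_abs_le (Real.log a)]
    · linarith [abs_nonneg (Real.log a)]

/-- Let `A > 0` a.s. with `E[A] = 1` and `log A` integrable.  Then for every `ρ > 0` and
`β ≥ 0`, the rate gap `Δ(ρ, β) = C̄(ρ) − R(ρ, β)` satisfies
`Δ(ρ, β) ≤ Δ̄(ρ) = E[ log(ρ + A) + log(ρ + 1/A) ] − 2·log(ρ + 1)`. -/
theorem stmt_9 {Ω : Type*} [MeasurableSpace Ω] (μ : Measure Ω) [IsProbabilityMeasure μ]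
    (A : Ω → ℝ) (hAmeas : Measurable A) (hApos : ∀ᵐ ω ∂μ, 0 < A ω)
    (hAint : Integrable A μ) (hAmean : ∫ ω, A ω ∂μ = 1)
    (hlog : Integrable (fun ω => Real.log (A ω)) μ) :
    ∀ ρ : ℝ, 0 < ρ → ∀ β : ℝ, 0 ≤ β →
      (∫ ω, Real.log (1 + A ω * ρ) ∂μ) -
        (∫ ω, Real.log ((ρ + 1) ^ 2 * ((1 + β) * A ω * ρ + 1) /
          ((β + 1) * ρ ^ 2 + (β * A ω + 2) * ρ + 1)) ∂μ) ≤
      (∫ ω, (Real.log (ρ + A ω) + Real.log (ρ + (A ω)⁻¹)) ∂μ) -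
        2 * Real.log (ρ + 1) := by
  intro ρ hρ β hβ
  have hA0 : ∀ᵐ ω ∂μ, 0 ≤ A ω := hApos.mono fun _ h => h.le
  have hC : Integrable (fun ω => Real.log (1 + A ω * ρ)) μ := by
    simpa only [mul_comm ρ] using integrable_log_const_add_mul hAint hA0 one_pos hρ.le
  have hsum : Integrable (fun ω => Real.log (ρ + A ω)) μ := by
    simpa only [one_mul] using integrable_log_const_add_mul hAint hA0 hρ zero_le_one
  have hN := integrable_log_const_add_mul hAint hA0 one_pos (b := (1 + β) * ρ) (by positivity)
  have hD := integrable_log_const_add_mul hAint hA0 (a := (β + 1) * ρ ^ 2 + 2 * ρ + 1)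
    (b := β * ρ) (by positivity) (by positivity)
  have hR : Integrable (fun ω => Real.log ((ρ + 1) ^ 2 * ((1 + β) * A ω * ρ + 1) /
      ((β + 1) * ρ ^ 2 + (β * A ω + 2) * ρ + 1))) μ := by
    refine (((integrable_const (2 * Real.log (ρ + 1))).add hN).sub hD).congr ?_
    filter_upwards [hApos] with ω hω
    rw [Real.log_div (by positivity) (by positivity), Real.log_mul (by positivity)
      (by positivity), Real.log_pow]
    simp only [Pi.add_apply, Pi.sub_apply]
    push_cast
    ring_nf
  have hlog_inv : ∀ x : ℝ, 0 < x →
      Real.log (ρ + x⁻¹) = Real.log (1 + x * ρ) - Real.log x := by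
    intro x hx
    rw [← Real.log_div (by positivity) hx.ne']
    congr 1
    field_simp
    ring
  have hinv : Integrable (fun ω => Real.log (ρ + (A ω)⁻¹)) μ :=
    (hC.sub hlog).congr (hApos.mono fun ω hω => (hlog_inv (A ω) hω).symm)
  have hbound : Integrable (fun ω => Real.log (ρ + A ω) + Real.log (ρ + (A ω)⁻¹)) μ :=
    hsum.add hinv
  have hconst : ∫ _ : Ω, 2 * Real.log (ρ + 1) ∂μ = 2 * Real.log (ρ + 1) := by simp
  rw [← integral_sub hC hR, ← hconst, ← integral_sub hbound (integrable_const _)]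
  refine integral_mono_ae (hC.sub hR) (hbound.sub (integrable_const _)) ?_
  filter_upwards [hApos] with ω hω
  have hkey : A ω * ((β + 1) * ρ ^ 2 + (β * A ω + 2) * ρ + 1) ≤
      (ρ + A ω) * ((1 + β) * A ω * ρ + 1) := by
    nlinarith [mul_nonneg hρ.le (sq_nonneg (1 - A ω))]
  have hlogkey := Real.log_le_log (by positivity) hkey
  rw [Real.log_mul (by positivity) (by positivity),
    Real.log_mul (by positivity) (by positivity)] at hlogkey
  rw [hlog_inv (A ω) hω, Real.log_div (by positivity) (by positivity),
    Real.log_mul (by positivity) (by positivity), Real.log_pow]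
  push_cast
  linarith
end

section
/- Suppose additionally that log A is integrable and E[1/A] < ∞. Then for every fixed β ≥ 0, the rate gap C̄(ρ) − R(ρ, β) tends to 0 as ρ → ∞; that is, the DPC scheme is asymptotically lossless at high SNR. -/
open MeasureTheory Filter Topology

/-- The ratio whose logarithm is the pointwise rate gap at gain `a` and SNR `ρ`. -/
noncomputable def rateGapRatio (β a ρ : ℝ) : ℝ :=
  (1 + a * ρ) * ((β + 1) * ρ ^ 2 + (β * a + 2) * ρ + 1) /
    ((ρ + 1) ^ 2 * ((1 + β) * a * ρ + 1))

lemma rateGapRatio_pos {β a ρ : ℝ} (hβ : 0 ≤ β) (ha : 0 < a) (hρ : 0 < ρ) :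
    0 < rateGapRatio β a ρ := by
  unfold rateGapRatio
  positivity

lemma log_rate_eq_sub {β a ρ : ℝ} (hβ : 0 ≤ β) (ha : 0 < a) (hρ : 0 < ρ) :
    Real.log ((ρ + 1) ^ 2 * ((1 + β) * a * ρ + 1) /
        ((β + 1) * ρ ^ 2 + (β * a + 2) * ρ + 1)) =
      Real.log (1 + a * ρ) - Real.log (rateGapRatio β a ρ) := by
  have h1 : 0 < 1 + a * ρ := by positivity
  have h2 : 0 < (β + 1) * ρ ^ 2 + (β * a + 2) * ρ + 1 := by positivity
  have h3 : 0 < (ρ + 1) ^ 2 * ((1 + β) * a * ρ + 1) := by positivity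
  rw [← Real.log_div h1.ne' (rateGapRatio_pos hβ ha hρ).ne']
  congr 1
  unfold rateGapRatio
  field_simp

lemma rateGapRatio_le {β a ρ : ℝ} (hβ : 0 ≤ β) (ha : 0 < a) (hρ : 0 < ρ) :
    rateGapRatio β a ρ ≤ 1 + β + β * a := by
  have hfactor : 1 + a * ρ ≤ (1 + β) * a * ρ + 1 := by
    nlinarith [mul_nonneg hβ (mul_pos ha hρ).le]
  have hquad : (β + 1) * ρ ^ 2 + (β * a + 2) * ρ + 1 ≤ (1 + β + β * a) * (ρ + 1) ^ 2 := by
    have h1 : 0 ≤ β * (2 * ρ + 1) := by positivity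
    have h2 : 0 ≤ β * a * (ρ ^ 2 + ρ + 1) := by positivity
    linarith
  unfold rateGapRatio
  rw [div_le_iff₀ (by positivity)]
  calc _ ≤ ((1 + β) * a * ρ + 1) * ((1 + β + β * a) * (ρ + 1) ^ 2) := by gcongr
    _ = _ := by ring

lemma inv_rateGapRatio_le {β a ρ : ℝ} (hβ : 0 ≤ β) (ha : 0 < a) (hρ : 0 < ρ) :
    (rateGapRatio β a ρ)⁻¹ ≤ 1 + β := by
  have hfactor : (1 + β) * a * ρ + 1 ≤ (1 + β) * (1 + a * ρ) := by linarith
  have hquad : (ρ + 1) ^ 2 ≤ (β + 1) * ρ ^ 2 + (β * a + 2) * ρ + 1 := by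
    have h1 : 0 ≤ β * ρ ^ 2 := by positivity
    have h2 : 0 ≤ β * a * ρ := by positivity
    linarith
  unfold rateGapRatio
  rw [inv_div, div_le_iff₀ (by positivity)]
  calc _ ≤ ((β + 1) * ρ ^ 2 + (β * a + 2) * ρ + 1) * ((1 + β) * (1 + a * ρ)) := by gcongr
    _ = _ := by ring

lemma abs_log_rateGapRatio_le {β a ρ : ℝ} (hβ : 0 ≤ β) (ha : 0 < a) (hρ : 0 < ρ) :
    |Real.log (rateGapRatio β a ρ)| ≤ β + β * a := by
  have hpos := rateGapRatio_pos hβ ha hρ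
  have hβa : 0 ≤ β * a := by positivity
  rw [abs_le]
  constructor
  · linarith [Real.one_sub_inv_le_log_of_pos hpos, inv_rateGapRatio_le hβ ha hρ]
  · linarith [Real.log_le_sub_one_of_pos hpos, rateGapRatio_le hβ ha hρ]

lemma tendsto_log_rateGapRatio {β a : ℝ} (hβ : 0 ≤ β) (ha : 0 < a) :
    Tendsto (fun ρ => Real.log (rateGapRatio β a ρ)) atTop (𝓝 0) := by
  have hden : (1 + (0 : ℝ)) ^ 2 * ((1 + β) * a + 0) ≠ 0 := by positivity
  have hcont : ContinuousAt (fun t : ℝ =>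
      (t + a) * ((β + 1) + (β * a + 2) * t + t ^ 2) / ((1 + t) ^ 2 * ((1 + β) * a + t))) 0 :=
    ContinuousAt.div (by fun_prop) (by fun_prop) hden
  have hlim := hcont.tendsto.comp tendsto_inv_atTop_zero
  have hval : (0 + a) * ((β + 1) + (β * a + 2) * 0 + 0 ^ 2) /
      ((1 + 0) ^ 2 * ((1 + β) * a + 0)) = 1 := by
    rw [div_eq_one_iff_eq hden]
    ring
  rw [hval] at hlim
  have hratio : Tendsto (rateGapRatio β a) atTop (𝓝 1) := by
    refine hlim.congr' ?_
    filter_upwards [eventually_gt_atTop 0] with ρ hρ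
    simp only [Function.comp_apply, rateGapRatio]
    field_simp
  simpa using hratio.log one_ne_zero

/-- Let `A > 0` a.s. with `E[A] = 1`, `log A` integrable and `E[1/A] < ∞`.  Then for
every fixed `β ≥ 0`, the rate gap `C̄(ρ) − R(ρ, β)` tends to `0` as `ρ → ∞`: the DPC
scheme is asymptotically lossless at high SNR. -/
theorem stmt_10 {Ω : Type*} [MeasurableSpace Ω] (μ : Measure Ω) [IsProbabilityMeasure μ]
    (A : Ω → ℝ) (hAmeas : Measurable A) (hApos : ∀ᵐ ω ∂μ, 0 < A ω)
    (hAint : Integrable A μ) (hAmean : ∫ ω, A ω ∂μ = 1)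
    (hlog : Integrable (fun ω => Real.log (A ω)) μ)
    (hinv : Integrable (fun ω => (A ω)⁻¹) μ)
    (β : ℝ) (hβ : 0 ≤ β) :
    Tendsto
      (fun ρ : ℝ =>
        (∫ ω, Real.log (1 + A ω * ρ) ∂μ) -
          (∫ ω, Real.log ((ρ + 1) ^ 2 * ((1 + β) * A ω * ρ + 1) /
            ((β + 1) * ρ ^ 2 + (β * A ω + 2) * ρ + 1)) ∂μ))
      atTop (𝓝 0) := by
  have hmeas (ρ : ℝ) : Measurable fun ω => Real.log (rateGapRatio β (A ω) ρ) := by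
    unfold rateGapRatio
    fun_prop
  have hbound : ∀ ρ > 0, ∀ᵐ ω ∂μ, ‖Real.log (rateGapRatio β (A ω) ρ)‖ ≤ β + β * A ω := by
    intro ρ hρ
    filter_upwards [hApos] with ω hω
    exact abs_log_rateGapRatio_le hβ hω hρ
  have hdom : Integrable (fun ω => β + β * A ω) μ :=
    (integrable_const β).add (hAint.const_mul β)
  have hgap : Tendsto (fun ρ => ∫ ω, Real.log (rateGapRatio β (A ω) ρ) ∂μ) atTop (𝓝 0) := by
    have h := tendsto_integral_filter_of_dominated_convergence (μ := μ) (l := atTop)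
      (F := fun ρ ω => Real.log (rateGapRatio β (A ω) ρ)) (f := fun _ => 0)
      (fun ω => β + β * A ω)
      (Eventually.of_forall fun ρ => (hmeas ρ).aestronglyMeasurable)
      ((eventually_gt_atTop 0).mono hbound) hdom
      (hApos.mono fun ω hω => tendsto_log_rateGapRatio hβ hω)
    simpa using h
  refine hgap.congr' ?_
  filter_upwards [eventually_gt_atTop 0] with ρ hρ
  have hcapMeas : Measurable fun ω => Real.log (1 + A ω * ρ) := by fun_prop
  have hcap : Integrable (fun ω => Real.log (1 + A ω * ρ)) μ := by
    refine (hAint.mul_const ρ).mono' hcapMeas.aestronglyMeasurable ?_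
    filter_upwards [hApos] with ω hω
    have hpos : 0 < A ω * ρ := mul_pos hω hρ
    rw [Real.norm_of_nonneg (Real.log_nonneg (by linarith))]
    linarith [Real.log_le_sub_one_of_pos (show 0 < 1 + A ω * ρ by linarith)]
  have hgapInt : Integrable (fun ω => Real.log (rateGapRatio β (A ω) ρ)) μ :=
    hdom.mono' (hmeas ρ).aestronglyMeasurable (hbound ρ hρ)
  rw [integral_congr_ae (hApos.mono fun ω hω => log_rate_eq_sub hβ hω hρ),
    integral_sub hcap hgapInt, sub_sub_cancel]
end

section
/- Suppose additionally that log A is integrable and E[1/A] < ∞. Then for every fixed β ≥ 0, ρ·( R(ρ, β) − log ρ − E[log A] ) tends to (β + E[1/A]) / (β + 1) as ρ → ∞. -/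
open MeasureTheory Filter Topology

/-- Factorisation of the normalised rate integrand into three `log (1 + x / ρ)` terms. -/
theorem log_rate_sub_log_sub_log {a ρ β : ℝ} (ha : 0 < a) (hρ : 0 < ρ) (hβ : 0 ≤ β) :
    Real.log ((ρ + 1) ^ 2 * ((1 + β) * a * ρ + 1) /
        ((β + 1) * ρ ^ 2 + (β * a + 2) * ρ + 1)) - Real.log ρ - Real.log a =
      2 * Real.log (1 + 1 / ρ) + Real.log (1 + a⁻¹ / (β + 1) / ρ) -
        Real.log (1 + (β * a + 2 + ρ⁻¹) / (β + 1) / ρ) := by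
  have hb : 0 < β + 1 := by linarith
  have hba : 0 ≤ β * a := by positivity
  have hsq : 2 * Real.log (1 + 1 / ρ) = Real.log ((1 + 1 / ρ) ^ 2) := by
    rw [Real.log_pow]; norm_num
  have h1 : (0 : ℝ) < (1 + 1 / ρ) ^ 2 := by positivity
  have h2 : 0 < 1 + a⁻¹ / (β + 1) / ρ := by positivity
  have h3 : 0 < 1 + (β * a + 2 + ρ⁻¹) / (β + 1) / ρ := by positivity
  have hq : 0 < (ρ + 1) ^ 2 * ((1 + β) * a * ρ + 1) /
      ((β + 1) * ρ ^ 2 + (β * a + 2) * ρ + 1) := by positivity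
  rw [hsq, ← Real.log_mul h1.ne' h2.ne', ← Real.log_div (mul_pos h1 h2).ne' h3.ne',
    ← Real.log_div hq.ne' hρ.ne', ← Real.log_div (div_pos hq hρ).ne' ha.ne']
  congr 1
  have hd : (β + 1) * ρ ^ 2 + (β * a + 2) * ρ + 1 ≠ 0 := by positivity
  have hd' : 1 + (β * a + 2 + ρ⁻¹) / (β + 1) / ρ =
      ((β + 1) * ρ ^ 2 + (β * a + 2) * ρ + 1) / ((β + 1) * ρ ^ 2) := by
    field_simp
    ring
  rw [hd']
  field_simp
  ring

/-- For `0 ≤ x` and `0 < ρ`, the quantity `ρ * log (1 + x / ρ)` lies in `[0, x]`. -/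
theorem mul_log_one_add_div_mem_Icc {x ρ : ℝ} (hx : 0 ≤ x) (hρ : 0 < ρ) :
    ρ * Real.log (1 + x / ρ) ∈ Set.Icc 0 x := by
  have hxρ : 0 ≤ x / ρ := by positivity
  constructor
  · exact mul_nonneg hρ.le (Real.log_nonneg (by linarith))
  · have h : Real.log (1 + x / ρ) ≤ x / ρ := by
      have := Real.log_le_sub_one_of_pos (show 0 < 1 + x / ρ by linarith)
      linarith
    calc ρ * Real.log (1 + x / ρ) ≤ ρ * (x / ρ) := by gcongr
      _ = x := by field_simp

/-- Integrable bound for the rescaled rate deficit when `1 ≤ ρ`. -/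
theorem abs_mul_log_rate_sub_le {a ρ β : ℝ} (ha : 0 < a) (hρ : 1 ≤ ρ) (hβ : 0 ≤ β) :
    |ρ * (Real.log ((ρ + 1) ^ 2 * ((1 + β) * a * ρ + 1) /
        ((β + 1) * ρ ^ 2 + (β * a + 2) * ρ + 1)) - Real.log ρ - Real.log a)| ≤
      2 + a⁻¹ / (β + 1) + (β * a + 3) / (β + 1) := by
  have hρ0 : 0 < ρ := by linarith
  have hba : 0 ≤ β * a := by positivity
  rw [log_rate_sub_log_sub_log ha hρ0 hβ]
  obtain ⟨l1, u1⟩ := mul_log_one_add_div_mem_Icc zero_le_one hρ0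
  obtain ⟨l2, u2⟩ := mul_log_one_add_div_mem_Icc (x := a⁻¹ / (β + 1)) (by positivity) hρ0
  obtain ⟨l3, u3⟩ := mul_log_one_add_div_mem_Icc
    (x := (β * a + 2 + ρ⁻¹) / (β + 1)) (by positivity) hρ0
  have h3 : (β * a + 2 + ρ⁻¹) / (β + 1) ≤ (β * a + 3) / (β + 1) := by
    have := inv_le_one_of_one_le₀ hρ
    gcongr ?_ / _
    linarith
  rw [abs_le]
  constructor <;> linarith

/-- Pointwise limit of the rescaled rate deficit. -/
theorem tendsto_mul_log_rate_sub {a β : ℝ} (ha : 0 < a) (hβ : 0 ≤ β) :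
    Tendsto (fun ρ : ℝ => ρ * (Real.log ((ρ + 1) ^ 2 * ((1 + β) * a * ρ + 1) /
        ((β + 1) * ρ ^ 2 + (β * a + 2) * ρ + 1)) - Real.log ρ - Real.log a))
      atTop (𝓝 (2 + a⁻¹ / (β + 1) - (β * a + 2) / (β + 1))) := by
  have h1 := (Real.tendsto_mul_log_one_add_div_atTop 1).const_mul 2
  have h2 := Real.tendsto_mul_log_one_add_div_atTop (a⁻¹ / (β + 1))
  have h3 : Tendsto (fun ρ : ℝ => ρ * Real.log (1 + (β * a + 2 + ρ⁻¹) / (β + 1) / ρ))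
      atTop (𝓝 ((β * a + 2) / (β + 1))) := by
    apply Real.tendsto_mul_log_one_add_of_tendsto
    have h : Tendsto (fun ρ : ℝ => (β * a + 2 + ρ⁻¹) / (β + 1)) atTop
        (𝓝 ((β * a + 2 + 0) / (β + 1))) :=
      (tendsto_inv_atTop_zero.const_add _).div_const _
    rw [add_zero] at h
    refine h.congr' ?_
    filter_upwards [eventually_gt_atTop 0] with ρ hρ
    field_simp
  have h := (h1.add h2).sub h3
  rw [mul_one] at h
  refine h.congr' ?_
  filter_upwards [eventually_gt_atTop 0] with ρ hρ
  rw [log_rate_sub_log_sub_log ha hρ hβ]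
  ring

/-- Let `A > 0` a.s. with `E[A] = 1`, `log A` integrable and `E[1/A] < ∞`.  Then for
every fixed `β ≥ 0`, `ρ·( R(ρ, β) − log ρ − E[log A] )` tends to
`(β + E[1/A]) / (β + 1)` as `ρ → ∞`. -/
theorem stmt_11 {Ω : Type*} [MeasurableSpace Ω] (μ : Measure Ω) [IsProbabilityMeasure μ]
    (A : Ω → ℝ) (hAmeas : Measurable A) (hApos : ∀ᵐ ω ∂μ, 0 < A ω)
    (hAint : Integrable A μ) (hAmean : ∫ ω, A ω ∂μ = 1)
    (hlog : Integrable (fun ω => Real.log (A ω)) μ)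
    (hinv : Integrable (fun ω => (A ω)⁻¹) μ)
    (β : ℝ) (hβ : 0 ≤ β) :
    Tendsto
      (fun ρ : ℝ =>
        ρ * ((∫ ω, Real.log ((ρ + 1) ^ 2 * ((1 + β) * A ω * ρ + 1) /
            ((β + 1) * ρ ^ 2 + (β * A ω + 2) * ρ + 1)) ∂μ) -
          Real.log ρ - ∫ ω, Real.log (A ω) ∂μ))
      atTop (𝓝 ((β + ∫ ω, (A ω)⁻¹ ∂μ) / (β + 1))) := by
  have hb : β + 1 ≠ 0 := by positivity
  set G : ℝ → Ω → ℝ := fun ρ ω => Real.log ((ρ + 1) ^ 2 * ((1 + β) * A ω * ρ + 1) /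
    ((β + 1) * ρ ^ 2 + (β * A ω + 2) * ρ + 1))
  set F : ℝ → Ω → ℝ := fun ρ ω => ρ * (G ρ ω - Real.log ρ - Real.log (A ω)) with hF
  have hFm (ρ : ℝ) : AEStronglyMeasurable (F ρ) μ := by
    apply Measurable.aestronglyMeasurable
    fun_prop
  have hbound : Integrable
      (fun ω => 2 + (A ω)⁻¹ / (β + 1) + (β * A ω + 3) / (β + 1)) μ :=
    ((integrable_const _).add (hinv.div_const _)).add
      (((hAint.const_mul β).add (integrable_const _)).div_const _)
  have hle (ρ : ℝ) (hρ : 1 ≤ ρ) :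
      ∀ᵐ ω ∂μ, ‖F ρ ω‖ ≤ 2 + (A ω)⁻¹ / (β + 1) + (β * A ω + 3) / (β + 1) := by
    filter_upwards [hApos] with ω hω
    exact abs_mul_log_rate_sub_le hω hρ hβ
  have hlim : Tendsto (fun ρ => ∫ ω, F ρ ω ∂μ) atTop
      (𝓝 (∫ ω, (2 + (A ω)⁻¹ / (β + 1) - (β * A ω + 2) / (β + 1)) ∂μ)) := by
    refine tendsto_integral_filter_of_dominated_convergence _ (.of_forall hFm) ?_ hbound ?_
    · filter_upwards [eventually_ge_atTop 1] with ρ hρ using hle ρ hρ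
    · filter_upwards [hApos] with ω hω using tendsto_mul_log_rate_sub hω hβ
  have hval : ∫ ω, (2 + (A ω)⁻¹ / (β + 1) - (β * A ω + 2) / (β + 1)) ∂μ =
      (β + ∫ ω, (A ω)⁻¹ ∂μ) / (β + 1) := by
    have h1 : Integrable (fun ω => 2 + (A ω)⁻¹ / (β + 1)) μ :=
      (integrable_const _).add (hinv.div_const _)
    have h2 : Integrable (fun ω => (β * A ω + 2) / (β + 1)) μ :=
      ((hAint.const_mul β).add (integrable_const _)).div_const _
    rw [integral_sub h1 h2, integral_add (integrable_const _) (hinv.div_const _), integral_div, integral_div,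
      integral_add (hAint.const_mul β) (integrable_const _), integral_const_mul, hAmean]
    simp only [integral_const, probReal_univ, one_smul]
    field_simp
    ring
  rw [hval] at hlim
  refine hlim.congr' ?_
  filter_upwards [eventually_ge_atTop 1] with ρ hρ
  have hFint : Integrable (F ρ) μ := hbound.mono' (hFm ρ) (hle ρ hρ)
  have hGint : Integrable (G ρ) μ := by
    refine (((hFint.const_mul ρ⁻¹).add (integrable_const (Real.log ρ))).add hlog).congr
      (.of_forall fun ω => ?_)
    simp only [Pi.add_apply, hF]
    field_simp
    ring
  have hsub : Integrable (fun ω => G ρ ω - Real.log ρ) μ := hGint.sub (integrable_const _)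
  simp only [hF]
  rw [integral_const_mul, integral_sub hsub hlog,
    integral_sub hGint (integrable_const _)]
  simp [G]
end

section
/- Suppose additionally that log A is integrable and E[1/A] < ∞. Then ρ·( C̄(ρ) − log ρ − E[log A] ) tends to E[1/A] as ρ → ∞. -/
open MeasureTheory Filter Topology

lemma log_one_add_mul_eq {a ρ : ℝ} (ha : 0 < a) (hρ : 0 < ρ) :
    Real.log (1 + a * ρ) = Real.log (1 + a⁻¹ / ρ) + Real.log ρ + Real.log a := by
  have h : 0 < 1 + a⁻¹ / ρ := by positivity
  rw [← Real.log_mul h.ne' hρ.ne', ← Real.log_mul (by positivity) ha.ne']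
  congr 1
  field_simp
  ring

lemma abs_mul_log_one_add_div_le {t ρ : ℝ} (ht : 0 ≤ t) (hρ : 0 < ρ) :
    |ρ * Real.log (1 + t / ρ)| ≤ t := by
  have h : 0 ≤ t / ρ := by positivity
  rw [abs_of_nonneg (mul_nonneg hρ.le (Real.log_nonneg (by linarith)))]
  calc ρ * Real.log (1 + t / ρ) ≤ ρ * (t / ρ) := by
        gcongr
        linarith [Real.log_le_sub_one_of_pos (show 0 < 1 + t / ρ by linarith)]
    _ = t := by field_simp

/-- Let `A > 0` a.s. with `E[A] = 1`, `log A` integrable and `E[1/A] < ∞`.  Then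
`ρ·( C̄(ρ) − log ρ − E[log A] )` tends to `E[1/A]` as `ρ → ∞`. -/
theorem stmt_12 {Ω : Type*} [MeasurableSpace Ω] (μ : Measure Ω) [IsProbabilityMeasure μ]
    (A : Ω → ℝ) (hAmeas : Measurable A) (hApos : ∀ᵐ ω ∂μ, 0 < A ω)
    (hAint : Integrable A μ) (hAmean : ∫ ω, A ω ∂μ = 1)
    (hlog : Integrable (fun ω => Real.log (A ω)) μ)
    (hinv : Integrable (fun ω => (A ω)⁻¹) μ) :
    Tendsto
      (fun ρ : ℝ =>
        ρ * ((∫ ω, Real.log (1 + A ω * ρ) ∂μ) - Real.log ρ - ∫ ω, Real.log (A ω) ∂μ))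
      atTop (𝓝 (∫ ω, (A ω)⁻¹ ∂μ)) := by
  have hbound : ∀ ρ : ℝ, 0 < ρ →
      ∀ᵐ ω ∂μ, ‖ρ * Real.log (1 + (A ω)⁻¹ / ρ)‖ ≤ (A ω)⁻¹ := fun ρ hρ => by
    filter_upwards [hApos] with ω hω
    exact abs_mul_log_one_add_div_le (inv_nonneg.2 hω.le) hρ
  have hmeas : ∀ ρ : ℝ, AEStronglyMeasurable (fun ω => ρ * Real.log (1 + (A ω)⁻¹ / ρ)) μ :=
    fun ρ => Measurable.aestronglyMeasurable (by fun_prop)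
  have hlim : Tendsto (fun ρ : ℝ => ∫ ω, ρ * Real.log (1 + (A ω)⁻¹ / ρ) ∂μ) atTop
      (𝓝 (∫ ω, (A ω)⁻¹ ∂μ)) := by
    refine tendsto_integral_filter_of_dominated_convergence (fun ω => (A ω)⁻¹)
      (Eventually.of_forall hmeas) ?_ hinv ?_
    · filter_upwards [eventually_gt_atTop 0] with ρ hρ using hbound ρ hρ
    · exact Eventually.of_forall fun ω => Real.tendsto_mul_log_one_add_div_atTop _
  refine hlim.congr' ?_
  filter_upwards [eventually_gt_atTop 0] with ρ hρ
  have hint : Integrable (fun ω => Real.log (1 + (A ω)⁻¹ / ρ)) μ := by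
    have h := (hinv.mono' (hmeas ρ) (hbound ρ hρ)).const_mul ρ⁻¹
    simpa [inv_mul_cancel_left₀ hρ.ne'] using h
  have hsplit : ∫ ω, Real.log (1 + A ω * ρ) ∂μ =
      ∫ ω, (Real.log (1 + (A ω)⁻¹ / ρ) + Real.log ρ + Real.log (A ω)) ∂μ := by
    refine integral_congr_ae ?_
    filter_upwards [hApos] with ω hω using log_one_add_mul_eq hω hρ
  rw [hsplit, integral_add (hint.fun_add (integrable_const _)) hlog,
    integral_add hint (integrable_const _), integral_const_mul, integral_const,
    probReal_univ, one_smul]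
  ring
end

section
/- Suppose additionally that E[A²] < ∞. Then for every fixed β ≥ 0, the ratio R(ρ, β) / C̄(ρ) tends to 1 as ρ → 0⁺; that is, the DPC scheme is asymptotically lossless at low SNR. -/
open MeasureTheory Filter Topology

/-- If `f 0 = 0` and `|f ρ| ≤ ρ * b` for an integrable `b`, then the right difference quotients at
`0` of `ρ ↦ ∫ f ρ` converge to the integral of the pointwise derivative. -/
theorem tendsto_inv_mul_integral_of_hasDerivAt_zero {Ω : Type*} [MeasurableSpace Ω]
    {μ : Measure Ω} {f : ℝ → Ω → ℝ} {f' b : Ω → ℝ}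
    (hmeas : ∀ ρ, AEStronglyMeasurable (f ρ) μ) (hb : Integrable b μ)
    (hbound : ∀ ρ ∈ Set.Ioo (0 : ℝ) 1, ∀ᵐ ω ∂μ, |f ρ ω| ≤ ρ * b ω)
    (hzero : ∀ ω, f 0 ω = 0)
    (hderiv : ∀ᵐ ω ∂μ, HasDerivAt (fun ρ => f ρ ω) (f' ω) 0) :
    Tendsto (fun ρ : ℝ => ρ⁻¹ * ∫ ω, f ρ ω ∂μ) (𝓝[>] 0) (𝓝 (∫ ω, f' ω ∂μ)) := by
  simp_rw [← integral_const_mul]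
  refine tendsto_integral_filter_of_dominated_convergence b
    (Eventually.of_forall fun ρ => (hmeas ρ).const_mul _) ?_ hb ?_
  · filter_upwards [Ioo_mem_nhdsGT (zero_lt_one' ℝ)] with ρ hρ
    filter_upwards [hbound ρ hρ] with ω hω
    rw [Real.norm_eq_abs, abs_mul, abs_of_pos (inv_pos.2 hρ.1)]
    exact (inv_mul_le_iff₀ hρ.1).2 hω
  · filter_upwards [hderiv] with ω hω
    simpa [hzero] using hω.tendsto_slope_zero_right

theorem abs_log_one_add_mul_le {a ρ : ℝ} (ha : 0 < a) (hρ : 0 < ρ) :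
    |Real.log (1 + a * ρ)| ≤ ρ * a := by
  have h : 0 < a * ρ := mul_pos ha hρ
  rw [abs_of_nonneg (Real.log_nonneg (by linarith))]
  linarith [Real.log_le_sub_one_of_pos (by linarith : 0 < 1 + a * ρ)]

theorem hasDerivAt_log_one_add_mul_zero (a : ℝ) :
    HasDerivAt (fun ρ : ℝ => Real.log (1 + a * ρ)) a 0 := by
  have h : HasDerivAt (fun ρ : ℝ => 1 + a * ρ) a 0 := by
    simpa using ((hasDerivAt_id (0 : ℝ)).const_mul a).const_add 1
  simpa using h.log (by simp)

theorem abs_log_dpc_le {a β ρ : ℝ} (ha : 0 < a) (hβ : 0 ≤ β) (hρ : ρ ∈ Set.Ioo (0 : ℝ) 1) :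
    |Real.log ((ρ + 1) ^ 2 * ((1 + β) * a * ρ + 1) /
      ((β + 1) * ρ ^ 2 + (β * a + 2) * ρ + 1))| ≤ ρ * ((1 + 2 * β) * a + (β + 5)) := by
  obtain ⟨h0, h1⟩ := hρ
  have hx : 0 < (1 + β) * a * ρ := by positivity
  have hy : 0 < (β + 1) * ρ ^ 2 + (β * a + 2) * ρ := by positivity
  rw [Real.log_div (by positivity) (by positivity), Real.log_mul (by positivity) (by positivity),
    Real.log_pow]
  have l1 := Real.log_nonneg (by linarith : 1 ≤ ρ + 1)
  have l2 := Real.log_nonneg (by linarith : 1 ≤ (1 + β) * a * ρ + 1)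
  have l3 := Real.log_nonneg (by linarith : 1 ≤ (β + 1) * ρ ^ 2 + (β * a + 2) * ρ + 1)
  have u1 := Real.log_le_sub_one_of_pos (by linarith : 0 < ρ + 1)
  have u2 := Real.log_le_sub_one_of_pos (by linarith : 0 < (1 + β) * a * ρ + 1)
  have u3 := Real.log_le_sub_one_of_pos
    (by linarith : 0 < (β + 1) * ρ ^ 2 + (β * a + 2) * ρ + 1)
  have hsq : (β + 1) * ρ ^ 2 ≤ (β + 1) * ρ := by
    gcongr
    nlinarith
  have hβaρ : 0 ≤ β * a * ρ := by positivity
  have hβρ : 0 ≤ β * ρ := by positivity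
  push_cast
  rw [abs_le]
  constructor <;> nlinarith

theorem hasDerivAt_log_dpc_zero (a β : ℝ) :
    HasDerivAt (fun ρ : ℝ => Real.log ((ρ + 1) ^ 2 * ((1 + β) * a * ρ + 1) /
      ((β + 1) * ρ ^ 2 + (β * a + 2) * ρ + 1))) a 0 := by
  have hid := hasDerivAt_id (0 : ℝ)
  have hnum := ((hid.add_const 1).pow 2).mul ((hid.const_mul ((1 + β) * a)).add_const 1)
  have hden := (((hid.pow 2).const_mul (β + 1)).add (hid.const_mul (β * a + 2))).add_const 1
  have h := (hnum.div hden (by simp)).log (by simp)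
  refine h.congr_deriv ?_
  simp
  ring

/-- Let `A > 0` a.s. with `E[A] = 1` and `E[A²] < ∞`.  Then for every fixed `β ≥ 0`,
the ratio `R(ρ, β) / C̄(ρ)` tends to `1` as `ρ → 0⁺`: the DPC scheme is asymptotically
lossless at low SNR. -/
theorem stmt_15 {Ω : Type*} [MeasurableSpace Ω] (μ : Measure Ω) [IsProbabilityMeasure μ]
    (A : Ω → ℝ) (hAmeas : Measurable A) (hApos : ∀ᵐ ω ∂μ, 0 < A ω)
    (hAint : Integrable A μ) (hAmean : ∫ ω, A ω ∂μ = 1)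
    (hsq : Integrable (fun ω => (A ω) ^ 2) μ)
    (β : ℝ) (hβ : 0 ≤ β) :
    Tendsto
      (fun ρ : ℝ =>
        (∫ ω, Real.log ((ρ + 1) ^ 2 * ((1 + β) * A ω * ρ + 1) /
            ((β + 1) * ρ ^ 2 + (β * A ω + 2) * ρ + 1)) ∂μ) /
          (∫ ω, Real.log (1 + A ω * ρ) ∂μ))
      (𝓝[>] 0) (𝓝 1) := by
  have hnum := tendsto_inv_mul_integral_of_hasDerivAt_zero (μ := μ) (f' := A)
    (f := fun ρ ω => Real.log ((ρ + 1) ^ 2 * ((1 + β) * A ω * ρ + 1) /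
      ((β + 1) * ρ ^ 2 + (β * A ω + 2) * ρ + 1)))
    (fun ρ => (Measurable.aestronglyMeasurable (by fun_prop)))
    ((hAint.const_mul (1 + 2 * β)).add (integrable_const (β + 5)))
    (fun ρ hρ => hApos.mono fun ω hω => abs_log_dpc_le hω hβ hρ)
    (fun ω => by simp)
    (Eventually.of_forall fun ω => hasDerivAt_log_dpc_zero (A ω) β)
  have hden := tendsto_inv_mul_integral_of_hasDerivAt_zero (μ := μ) (f' := A)
    (f := fun ρ ω => Real.log (1 + A ω * ρ))
    (fun ρ => (Measurable.aestronglyMeasurable (by fun_prop))) hAint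
    (fun ρ hρ => hApos.mono fun ω hω => abs_log_one_add_mul_le hω hρ.1)
    (fun ω => by simp)
    (Eventually.of_forall fun ω => hasDerivAt_log_one_add_mul_zero (A ω))
  rw [hAmean] at hnum hden
  have h := hnum.div hden one_ne_zero
  rw [div_one] at h
  refine h.congr' ?_
  filter_upwards [self_mem_nhdsWithin] with ρ hρ
  exact mul_div_mul_left _ _ (inv_ne_zero (ne_of_gt hρ))
end

section
/- Let ρ > 0 and let g₁ ≥ g₂ > 0. For every μ ∈ [0, 1] and every η₁, η₂ ≥ 0 with μ·η₁ + (1−μ)·η₂ = 1, there exists γ ∈ [0, 1] such that log(1 + γ·g₁·ρ) ≥ μ·log(1 + η₁·g₁·ρ) and log(1 + (1−γ)·g₂·ρ / (1 + γ·g₂·ρ)) ≥ (1−μ)·log(1 + η₂·g₂·ρ). In other words, the two-user DPC outage achievable rate region contains the time-division-with-power-allocation region. -/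
/-- Concavity of `x ↦ x ^ μ` along the segment from `1` to `1 + η * a`. -/
theorem one_add_div_mul_le_rpow {a b η μ : ℝ} (hb : 0 ≤ b) (hba : b ≤ a) (ha : 0 < a)
    (hη : 0 ≤ η) (hμ : 0 ≤ μ) (hμ' : μ ≤ 1) :
    1 + ((1 + η * a) ^ μ - 1) / a * b ≤ (1 + η * b) ^ μ := by
  have ht : b / a ≤ 1 := (div_le_one ha).2 hba
  have hx : (0 : ℝ) ≤ 1 + η * a := by positivity
  have h := (Real.concaveOn_rpow hμ hμ').2 (Set.mem_Ici.2 (zero_le_one' ℝ)) (Set.mem_Ici.2 hx)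
    (sub_nonneg.2 ht) (by positivity : 0 ≤ b / a) (by ring)
  simp only [smul_eq_mul, Real.one_rpow] at h
  have h₁ : (1 - b / a) * 1 + b / a * (1 + η * a) = 1 + η * b := by field_simp; ring
  rw [h₁] at h
  exact le_of_eq_of_le (by ring) h

/-- Let `ρ > 0` and `g₁ ≥ g₂ > 0`.  For every time-sharing factor `μ ∈ [0, 1]` and
power allocation `η₁, η₂ ≥ 0` with `μ·η₁ + (1−μ)·η₂ = 1`, there exists a power split
`γ ∈ [0, 1]` such that the two-user DPC rate pair dominates the time-division rate
pair: `log(1 + γ·g₁·ρ) ≥ μ·log(1 + η₁·g₁·ρ)` and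
`log(1 + (1−γ)·g₂·ρ/(1 + γ·g₂·ρ)) ≥ (1−μ)·log(1 + η₂·g₂·ρ)`. -/
theorem stmt_16 (ρ g₁ g₂ : ℝ) (hρ : 0 < ρ) (hg₂ : 0 < g₂) (hg : g₂ ≤ g₁) :
    ∀ μ ∈ Set.Icc (0 : ℝ) 1, ∀ η₁ : ℝ, 0 ≤ η₁ → ∀ η₂ : ℝ, 0 ≤ η₂ →
      μ * η₁ + (1 - μ) * η₂ = 1 →
      ∃ γ ∈ Set.Icc (0 : ℝ) 1,
        μ * Real.log (1 + η₁ * g₁ * ρ) ≤ Real.log (1 + γ * g₁ * ρ) ∧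
        (1 - μ) * Real.log (1 + η₂ * g₂ * ρ) ≤
          Real.log (1 + (1 - γ) * g₂ * ρ / (1 + γ * g₂ * ρ)) := by
  rintro μ ⟨hμ, hμ'⟩ η₁ hη₁ η₂ hη₂ hsum
  have hg₁ : 0 < g₁ := hg₂.trans_le hg
  have ha : 0 < g₁ * ρ := mul_pos hg₁ hρ
  have hb : 0 < g₂ * ρ := mul_pos hg₂ hρ
  have hba : g₂ * ρ ≤ g₁ * ρ := mul_le_mul_of_nonneg_right hg hρ.le
  simp only [mul_assoc _ g₁ ρ, mul_assoc _ g₂ ρ]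
  generalize g₁ * ρ = a at *
  generalize g₂ * ρ = b at *
  have hx : 1 ≤ 1 + η₁ * a := le_add_of_nonneg_right (by positivity)
  have hγ : 0 ≤ ((1 + η₁ * a) ^ μ - 1) / a :=
    div_nonneg (sub_nonneg.2 (Real.one_le_rpow hx hμ)) ha.le
  have hγ' : ((1 + η₁ * a) ^ μ - 1) / a ≤ 1 := by
    have h := rpow_one_add_le_one_add_mul_self (by linarith : -1 ≤ η₁ * a) hμ hμ'
    rw [div_le_one ha]
    nlinarith [mul_nonneg (mul_nonneg (sub_nonneg.2 hμ') hη₂) ha.le]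
  have hγb := one_add_div_mul_le_rpow hb.le hba ha hη₁ hμ hμ'
  have hγa : 1 + ((1 + η₁ * a) ^ μ - 1) / a * a = (1 + η₁ * a) ^ μ := by field_simp; ring
  generalize ((1 + η₁ * a) ^ μ - 1) / a = γ at *
  refine ⟨γ, ⟨hγ, hγ'⟩, ?_, ?_⟩
  · rw [hγa, Real.log_rpow (by linarith)]
  · have hc : 0 < 1 + γ * b := by positivity
    have hy : 0 < 1 + η₂ * b := by positivity
    have hsplit : 1 + (1 - γ) * b / (1 + γ * b) = (1 + b) / (1 + γ * b) := by
      field_simp; ring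
    have hmean := Real.geom_mean_le_arith_mean2_weighted hμ (sub_nonneg.2 hμ')
      (by positivity : 0 ≤ 1 + η₁ * b) hy.le (by ring)
    rw [show μ * (1 + η₁ * b) + (1 - μ) * (1 + η₂ * b) = 1 + b by
      linear_combination b * hsum] at hmean
    rw [hsplit, ← Real.log_rpow hy]
    refine Real.log_le_log (by positivity) ?_
    rw [le_div_iff₀ hc, mul_comm]
    exact (mul_le_mul_of_nonneg_right hγb (by positivity)).trans hmean
end

section
/- Let p, q > 0, w ≥ 0, R ≥ 0, and suppose p > (e^R − 1)·w. For a ≥ 0 define J̃(α, a) := log( p·(a·(p + q + w) + 1) / ((1−α)²·a·p·q + (p + α²·q)·(a·w + 1)) ). Then with α* := 1 − e^{−R}, for every a ≥ 0: J̃(α*, a) ≤ R if and only if log(1 + a·p/(a·w + 1)) ≤ R (equivalently, if and only if a ≤ (e^R − 1)/(p − (e^R − 1)·w)). That is, the DPC scheme achieves the same outage condition as if the known interference were absent, even when part of the noise is scaled by the fading coefficient. -/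
/-- The conditional DPC achievable rate when part of the noise is scaled by the fading
coefficient: `J̃(α, a) = log( p·(a·(p+q+w) + 1) /
((1−α)²·a·p·q + (p + α²·q)·(a·w + 1)) )`. -/
noncomputable def Jtilde (p q w α a : ℝ) : ℝ :=
  Real.log (p * (a * (p + q + w) + 1) /
    ((1 - α) ^ 2 * a * p * q + (p + α ^ 2 * q) * (a * w + 1)))

/-- With inflation parameter `1 - e^{-R}`, the DPC rate is at most `R` exactly when the
interference-free signal-to-noise condition `a p ≤ (e^R - 1) (a w + 1)` holds. -/
theorem Jtilde_one_sub_exp_neg_le_iff {p q w R a : ℝ} (hp : 0 < p) (hq : 0 < q) (hw : 0 ≤ w)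
    (hR : 0 ≤ R) (ha : 0 ≤ a) :
    Jtilde p q w (1 - Real.exp (-R)) a ≤ R ↔ a * p ≤ (Real.exp R - 1) * (a * w + 1) := by
  have ht : Real.exp (-R) ≤ 1 := Real.exp_le_one_iff.mpr (by linarith)
  have hEt : Real.exp R * Real.exp (-R) = 1 := by rw [← Real.exp_add]; simp
  unfold Jtilde
  generalize hE : Real.exp R = E at *
  generalize Real.exp (-R) = t at *
  have hden : 0 < (1 - (1 - t)) ^ 2 * a * p * q + (p + (1 - t) ^ 2 * q) * (a * w + 1) := by
    positivity
  have hfac : 0 < p + (1 - t) * q := by nlinarith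
  have key : E * ((1 - (1 - t)) ^ 2 * a * p * q + (p + (1 - t) ^ 2 * q) * (a * w + 1)) -
      p * (a * (p + q + w) + 1) = ((E - 1) * (a * w + 1) - a * p) * (p + (1 - t) * q) := by
    linear_combination (t * a * p * q + (t - 1) * q * (a * w + 1)) * hEt
  rw [Real.log_le_iff_le_exp (by positivity), hE, div_le_iff₀ hden, ← sub_nonneg, key,
    mul_nonneg_iff_of_pos_right hfac, sub_nonneg]

/-- Let `p, q > 0`, `w ≥ 0`, `R ≥ 0` with `p > (e^R − 1)·w`, and `α* = 1 − e^{−R}`.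
Then for every `a ≥ 0`, `J̃(α*, a) ≤ R` iff `log(1 + a·p/(a·w + 1)) ≤ R`, equivalently
iff `a ≤ (e^R − 1)/(p − (e^R − 1)·w)`: the DPC scheme achieves the same outage condition
as if the known interference were absent, even when part of the noise is scaled by the
fading coefficient. -/
theorem stmt_19 (p q w R : ℝ) (hp : 0 < p) (hq : 0 < q) (hw : 0 ≤ w) (hR : 0 ≤ R)
    (hpw : (Real.exp R - 1) * w < p) :
    ∀ a : ℝ, 0 ≤ a →
      (Jtilde p q w (1 - Real.exp (-R)) a ≤ R ↔
        Real.log (1 + a * p / (a * w + 1)) ≤ R) ∧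
      (Jtilde p q w (1 - Real.exp (-R)) a ≤ R ↔
        a ≤ (Real.exp R - 1) / (p - (Real.exp R - 1) * w)) := by
  intro a ha
  have hm : 0 < a * w + 1 := by positivity
  rw [Jtilde_one_sub_exp_neg_le_iff hp hq hw hR ha]
  constructor
  · rw [Real.log_le_iff_le_exp (by positivity), ← le_sub_iff_add_le', div_le_iff₀ hm]
  · rw [le_div_iff₀ (sub_pos.mpr hpw)]
    constructor <;> intro h <;> linarith
end
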